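/- arXiv:1705.05319 — 2 statements merged into one kernel-verified Lean document; each statement's English description precedes it below -/
import Mathlib

section
/- Let L be a finite sectionally complemented lattice. Then every congruence of L is principal; in fact, every congruence α of L equals con(0, a), where a is the largest element of L congruent to 0 modulo α. -/
/-- A congruence of a lattice: an equivalence relation compatible with `⊔` and `⊓`. -/
structure LatCon (L : Type*) [Lattice L] where
  r : L → L → Prop
  refl : ∀ a, r a a
  symm : ∀ {a b}, r a b → r b a
  trans : ∀ {a b c}, r a b → r b c → r a c
  sup_comp : ∀ {a b c d}, r a b → r c d → r (a ⊔ c) (b ⊔ d)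
  inf_comp : ∀ {a b c d}, r a b → r c d → r (a ⊓ c) (b ⊓ d)

namespace LatCon

variable {L : Type*} [Lattice L]

theorem ext' {θ ψ : LatCon L} (h : ∀ a b, θ.r a b ↔ ψ.r a b) : θ = ψ := by
  cases θ; cases ψ
  simp only [mk.injEq]
  funext a b
  exact propext (h a b)

/-- Congruences are ordered by containment. -/
instance : PartialOrder (LatCon L) where
  le θ ψ := ∀ a b, θ.r a b → ψ.r a b
  le_refl θ := fun _ _ h => h
  le_trans θ ψ χ h1 h2 := fun a b h => h2 a b (h1 a b h)
  le_antisymm θ ψ h1 h2 := ext' fun a b => ⟨h1 a b, h2 a b⟩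

instance : InfSet (LatCon L) where
  sInf S :=
    { r := fun a b => ∀ θ ∈ S, θ.r a b
      refl := fun a θ _ => θ.refl a
      symm := fun h θ hθ => θ.symm (h θ hθ)
      trans := fun h1 h2 θ hθ => θ.trans (h1 θ hθ) (h2 θ hθ)
      sup_comp := fun h1 h2 θ hθ => θ.sup_comp (h1 θ hθ) (h2 θ hθ)
      inf_comp := fun h1 h2 θ hθ => θ.inf_comp (h1 θ hθ) (h2 θ hθ) }

/-- `Con L`, the lattice of congruences of `L`, is a complete lattice. -/
instance : CompleteLattice (LatCon L) :=
  completeLatticeOfInf (LatCon L) fun S =>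
    ⟨fun θ hθ a b h => h θ hθ, fun ψ hψ a b h θ hθ => hψ hθ a b h⟩

/-- The principal congruence `con(a, b)`: the smallest congruence collapsing `a` and `b`. -/
def princ (a b : L) : LatCon L := sInf {θ : LatCon L | θ.r a b}

/-- A congruence is principal if it is of the form `con(a, b)`. -/
def IsPrincipal (θ : LatCon L) : Prop := ∃ a b : L, θ = princ a b

end LatCon

/-- `Princ L`, the set of principal congruences of a lattice `L`,
ordered by containment (the order inherited from `Con L`). -/
def Princ (L : Type*) [Lattice L] : Set (LatCon L) := {θ : LatCon L | θ.IsPrincipal}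

/-- `J⁺(D) = {⊥, ⊤} ∪ J(D)`, where `J(D)` is the set of join-irreducible elements. -/
def Jplus (D : Type*) [Lattice D] [BoundedOrder D] : Set D :=
  {⊥, ⊤} ∪ {x : D | SupIrred x}

/-- `Q ⊆ D` is principal congruence representable: there are a finite lattice `L` and
an order isomorphism `φ : Con L ≃o D` mapping `Princ L` exactly onto `Q`. -/
def Representable (D : Type*) [Lattice D] (Q : Set D) : Prop :=
  ∃ (L : Type) (_ : Lattice L) (_ : Fintype L) (φ : LatCon L ≃o D),
    φ '' Princ L = Q

/-- `D` is fully representable: every candidate `J⁺(D) ⊆ Q ⊆ D` is representable. -/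
def FullyRepresentable (D : Type*) [Lattice D] [BoundedOrder D] : Prop :=
  ∀ Q : Set D, Jplus D ⊆ Q → Representable D Q

universe u


/-- A lattice with least element is sectionally complemented if every interval `[⊥, b]`
is complemented: for `a ≤ b` there is `c` with `a ⊓ c = ⊥` and `a ⊔ c = b`. -/
def SectionallyComplemented (L : Type*) [Lattice L] [OrderBot L] : Prop :=
  ∀ a b : L, a ≤ b → ∃ c : L, a ⊓ c = ⊥ ∧ a ⊔ c = b

namespace LatCon

variable {L : Type*} [Lattice L]

theorem r_inf_sup_iff (θ : LatCon L) {x y : L} : θ.r (x ⊓ y) (x ⊔ y) ↔ θ.r x y := by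
  constructor
  · intro h
    have hx : θ.r x (x ⊔ y) := by simpa using θ.sup_comp (θ.refl x) h
    have hy : θ.r y (x ⊔ y) := by simpa using θ.sup_comp (θ.refl y) h
    exact θ.trans hx (θ.symm hy)
  · intro h
    have hi : θ.r (x ⊓ y) y := by simpa using θ.inf_comp h (θ.refl y)
    have hs : θ.r (x ⊔ y) y := by simpa using θ.sup_comp h (θ.refl y)
    exact θ.trans hi (θ.symm hs)

theorem princ_le_iff {θ : LatCon L} {a b : L} : princ a b ≤ θ ↔ θ.r a b :=
  ⟨fun h => h a b fun _ hψ => hψ, fun h _ _ hxy => hxy θ h⟩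

theorem r_bot_of_le [OrderBot L] (θ : LatCon L) {a c : L} (ha : θ.r ⊥ a) (hc : c ≤ a) :
    θ.r ⊥ c := by
  simpa [inf_eq_right.mpr hc] using θ.inf_comp ha (θ.refl c)

theorem exists_isGreatest_r_bot [OrderBot L] [Finite L] (θ : LatCon L) :
    ∃ a, IsGreatest {x | θ.r ⊥ x} a := by
  classical
  have := Fintype.ofFinite L
  refine ⟨(Finset.univ.filter (θ.r ⊥)).sup id, ?_, fun x hx => ?_⟩
  · refine Finset.sup_induction (p := θ.r ⊥) (θ.refl ⊥) (fun x hx y hy => ?_) (by simp)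
    simpa using θ.sup_comp hx hy
  · exact Finset.le_sup (f := id) (by simpa using hx)

/-- In a sectionally complemented lattice, congruences are ordered as their zero classes are. -/
theorem le_of_forall_r_bot [OrderBot L] (hL : SectionallyComplemented L) {θ ψ : LatCon L}
    (h : ∀ c, θ.r ⊥ c → ψ.r ⊥ c) : θ ≤ ψ := by
  intro x y hxy
  obtain ⟨c, hinf, hsup⟩ := hL (x ⊓ y) (x ⊔ y) inf_le_sup
  have hc : c ≤ x ⊔ y := hsup ▸ le_sup_right
  have hθ : θ.r ⊥ c := by
    have := θ.inf_comp (θ.r_inf_sup_iff.mpr hxy) (θ.refl c)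
    rwa [hinf, inf_eq_right.mpr hc] at this
  rw [← ψ.r_inf_sup_iff]
  have := ψ.sup_comp (ψ.refl (x ⊓ y)) (h c hθ)
  rwa [hsup, sup_bot_eq] at this

end LatCon

/-- **Lemma 5 (folklore).** In a finite sectionally complemented lattice every congruence
`α` is principal; indeed `α = con(⊥, a)` where `a` is the largest element with `a α ⊥`. -/
theorem congruence_principal_of_sectionally_complemented
    (L : Type*) [Lattice L] [OrderBot L] [Fintype L]
    (hL : SectionallyComplemented L) (α : LatCon L) :
    α.IsPrincipal ∧
    ∃ a : L, α.r ⊥ a ∧ (∀ x : L, α.r ⊥ x → x ≤ a) ∧ α = LatCon.princ ⊥ a := by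
  obtain ⟨a, ha, hmax⟩ := α.exists_isGreatest_r_bot
  have h : α = LatCon.princ ⊥ a :=
    le_antisymm
      (LatCon.le_of_forall_r_bot hL fun _ hc =>
        LatCon.r_bot_of_le _ (LatCon.princ_le_iff.mp le_rfl) (hmax hc))
      (LatCon.princ_le_iff.mpr ha)
  exact ⟨⟨⊥, a, h⟩, a, ha, fun _ hx => hmax hx, h⟩
end

section
/- Let D be a finite distributive lattice such that J⁺(D) = D, i.e., every element of D is the least element, the greatest element, or join-irreducible. Then D is fully representable. -/
universe u

namespace LatCon

variable {L : Type*} [Lattice L]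

/-- The kernel of a lattice homomorphism. -/
def ker {M : Type*} [Lattice M] (f : L → M) (hs : ∀ a b, f (a ⊔ b) = f a ⊔ f b)
    (hi : ∀ a b, f (a ⊓ b) = f a ⊓ f b) : LatCon L where
  r a b := f a = f b
  refl _ := rfl
  symm h := h.symm
  trans h1 h2 := h1.trans h2
  sup_comp h1 h2 := by rw [hs, hs, h1, h2]
  inf_comp h1 h2 := by rw [hi, hi, h1, h2]

theorem top_r (a b : L) : (⊤ : LatCon L).r a b :=
  (le_top : ker (fun _ => true) (by simp) (by simp) ≤ (⊤ : LatCon L)) a b rfl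

theorem princ_le {a b : L} {θ : LatCon L} (h : θ.r a b) : princ a b ≤ θ :=
  fun _ _ hx => hx θ h

theorem princ_r (a b : L) : (princ a b).r a b := fun _ h => h

theorem eq_top_of_r {θ : LatCon L} {x y : L} (hx : ∀ z, x ≤ z) (hy : ∀ z, z ≤ y)
    (h : θ.r x y) : θ = ⊤ := by
  have key : ∀ z, θ.r x z := fun z => by
    have := θ.inf_comp (θ.refl z) h
    rwa [inf_eq_right.2 (hx z), inf_eq_left.2 (hy z)] at this
  exact top_le_iff.1 fun p q _ => θ.trans (θ.symm (key p)) (key q)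

/-- In a finite nonempty lattice, the congruences in `J⁺` are principal. -/
theorem isPrincipal_of_mem_Jplus [Finite L] [Nonempty L] {θ : LatCon L}
    (h : θ = ⊥ ∨ θ = ⊤ ∨ SupIrred θ) : θ.IsPrincipal := by
  classical
  have := Fintype.ofFinite L
  rcases h with rfl | rfl | h
  · obtain ⟨a⟩ := ‹Nonempty L›
    exact ⟨a, a, le_antisymm bot_le (princ_le (refl _ a))⟩
  · let := Fintype.toBoundedOrder L
    exact ⟨⊥, ⊤, (eq_top_of_r (fun _ => bot_le) (fun _ => le_top) (princ_r _ _)).symm⟩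
  · have hsup : (Finset.univ.filter fun p : L × L => θ.r p.1 p.2).sup
        (fun p => princ p.1 p.2) = θ := by
      apply le_antisymm
      · refine Finset.sup_le fun p hp => princ_le ?_
        simpa using hp
      · intro a b hab
        exact Finset.le_sup (f := fun p : L × L => princ p.1 p.2) (b := (a, b))
          (by simpa using hab) a b (princ_r a b)
    obtain ⟨p, -, hp⟩ := h.finset_sup_eq hsup
    exact ⟨p.1, p.2, hp.symm⟩

end LatCon

/-- The lattice `L` together with a new least element, a new greatest element, and an antichain
of elements indexed by `K` that are complements of all elements of `L`. -/
inductive HSum (K L : Type) : Type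
  | bot : HSum K L
  | top : HSum K L
  | side : K → HSum K L
  | mid : L → HSum K L

namespace HSum

variable {K L : Type}

instance [Finite K] [Finite L] : Finite (HSum K L) := by
  refine Finite.of_surjective (α := Option (Option (K ⊕ L)))
    (fun
      | none => bot
      | some none => top
      | some (some (.inl k)) => side k
      | some (some (.inr x)) => mid x) ?_
  rintro (_ | _ | k | x)
  exacts [⟨none, rfl⟩, ⟨some none, rfl⟩, ⟨some (some (.inl k)), rfl⟩, ⟨some (some (.inr x)), rfl⟩]

variable [DecidableEq K] [Lattice L]

/-- The join operation. -/
def sup : HSum K L → HSum K L → HSum K L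
  | bot, q => q
  | top, _ => top
  | side i, bot => side i
  | side i, side j => if i = j then side i else top
  | side _, _ => top
  | mid x, bot => mid x
  | mid x, mid y => mid (x ⊔ y)
  | mid _, _ => top

/-- The meet operation. -/
def inf : HSum K L → HSum K L → HSum K L
  | top, q => q
  | bot, _ => bot
  | side i, top => side i
  | side i, side j => if i = j then side i else bot
  | side _, _ => bot
  | mid x, top => mid x
  | mid x, mid y => mid (x ⊓ y)
  | mid _, _ => bot

instance : Lattice (HSum K L) :=
  letI : Max (HSum K L) := ⟨sup⟩
  letI : Min (HSum K L) := ⟨inf⟩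
  Lattice.mk'
    (fun p q => by
      change sup p q = sup q p
      rcases p with _ | _ | i | x <;> rcases q with _ | _ | j | y <;> simp only [sup, sup_comm]
      grind)
    (fun p q s => by
      change sup (sup p q) s = sup p (sup q s)
      rcases p with _ | _ | i | x <;> rcases q with _ | _ | j | y <;>
        rcases s with _ | _ | k | z <;> grind [sup, sup_assoc])
    (fun p q => by
      change inf p q = inf q p
      rcases p with _ | _ | i | x <;> rcases q with _ | _ | j | y <;> simp only [inf, inf_comm]
      grind)
    (fun p q s => by
      change inf (inf p q) s = inf p (inf q s)
      rcases p with _ | _ | i | x <;> rcases q with _ | _ | j | y <;>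
        rcases s with _ | _ | k | z <;> grind [inf, inf_assoc])
    (fun p q => by
      change sup p (inf p q) = p
      rcases p with _ | _ | i | x <;> rcases q with _ | _ | j | y <;>
        grind [inf, sup, sup_inf_self])
    (fun p q => by
      change inf p (sup p q) = p
      rcases p with _ | _ | i | x <;> rcases q with _ | _ | j | y <;>
        grind [inf, sup, inf_sup_self])

theorem sup_def (p q : HSum K L) : p ⊔ q = sup p q := rfl

theorem inf_def (p q : HSum K L) : p ⊓ q = inf p q := rfl

theorem bot_le' (p : HSum K L) : bot ≤ p := sup_eq_right.1 rfl

theorem le_top' (p : HSum K L) : p ≤ top := inf_eq_right.1 rfl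

/-- The congruence of `HSum K L` that extends a congruence of `L` by the identity. -/
def extend (θ : LatCon L) : LatCon (HSum K L) where
  r p q := p = q ∨ ∃ x y, p = mid x ∧ q = mid y ∧ θ.r x y
  refl _ := .inl rfl
  symm := by
    rintro p q (rfl | ⟨x, y, rfl, rfl, h⟩)
    exacts [.inl rfl, .inr ⟨y, x, rfl, rfl, θ.symm h⟩]
  trans := by
    rintro p q s (rfl | ⟨x, y, rfl, rfl, h⟩) (rfl | ⟨x', y', hx, rfl, h'⟩)
    · exact .inl rfl
    · exact .inr ⟨x', y', hx, rfl, h'⟩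
    · exact .inr ⟨x, y, rfl, rfl, h⟩
    · cases hx
      exact .inr ⟨x, y', rfl, rfl, θ.trans h h'⟩
  sup_comp := by
    rintro p q s t (rfl | ⟨x, y, rfl, rfl, h⟩) (rfl | ⟨x', y', rfl, rfl, h'⟩)
    · exact .inl rfl
    · rcases p with _ | _ | i | z
      exacts [.inr ⟨_, _, rfl, rfl, h'⟩, .inl rfl, .inl rfl,
        .inr ⟨_, _, rfl, rfl, θ.sup_comp (θ.refl z) h'⟩]
    · rcases s with _ | _ | i | z
      exacts [.inr ⟨_, _, rfl, rfl, h⟩, .inl rfl, .inl rfl,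
        .inr ⟨_, _, rfl, rfl, θ.sup_comp h (θ.refl z)⟩]
    · exact .inr ⟨_, _, rfl, rfl, θ.sup_comp h h'⟩
  inf_comp := by
    rintro p q s t (rfl | ⟨x, y, rfl, rfl, h⟩) (rfl | ⟨x', y', rfl, rfl, h'⟩)
    · exact .inl rfl
    · rcases p with _ | _ | i | z
      exacts [.inl rfl, .inr ⟨_, _, rfl, rfl, h'⟩, .inl rfl,
        .inr ⟨_, _, rfl, rfl, θ.inf_comp (θ.refl z) h'⟩]
    · rcases s with _ | _ | i | z
      exacts [.inl rfl, .inr ⟨_, _, rfl, rfl, h⟩, .inl rfl,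
        .inr ⟨_, _, rfl, rfl, θ.inf_comp h (θ.refl z)⟩]
    · exact .inr ⟨_, _, rfl, rfl, θ.inf_comp h h'⟩

/-- The restriction of a congruence of `HSum K L` to `L`. -/
def restrict (ρ : LatCon (HSum K L)) : LatCon L where
  r x y := ρ.r (mid x) (mid y)
  refl _ := ρ.refl _
  symm h := ρ.symm h
  trans h h' := ρ.trans h h'
  sup_comp h h' := ρ.sup_comp h h'
  inf_comp h h' := ρ.inf_comp h h'

theorem extend_le_iff {θ : LatCon L} {ρ : LatCon (HSum K L)} :
    extend θ ≤ ρ ↔ θ ≤ restrict ρ := by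
  constructor
  · exact fun h x y hxy => h _ _ (.inr ⟨x, y, rfl, rfl, hxy⟩)
  · rintro h p q (rfl | ⟨x, y, rfl, rfl, hxy⟩)
    exacts [ρ.refl _, h x y hxy]

theorem restrict_extend (θ : LatCon L) : restrict (extend θ : LatCon (HSum K L)) = θ := by
  refine le_antisymm ?_ (extend_le_iff.1 le_rfl)
  rintro x y (h | ⟨x', y', h, h', hxy⟩)
  · cases h
    exact θ.refl x
  · cases h
    cases h'
    exact hxy

theorem extend_le_extend {θ ψ : LatCon L} :
    (extend θ : LatCon (HSum K L)) ≤ extend ψ ↔ θ ≤ ψ := by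
  rw [extend_le_iff, restrict_extend]

theorem not_le_extend {ρ : LatCon (HSum K L)} {i : K} (θ : LatCon L)
    (h : ρ.r bot (side i) ∨ ρ.r (side i) top) : ¬ ρ ≤ extend θ := by
  intro hle
  rcases h with h | h <;> rcases hle _ _ h with h | ⟨x, y, h, h', -⟩ <;> simp at *

theorem mid_top {ρ : LatCon (HSum K L)} {i : K} (h : ρ.r bot (side i)) (x : L) :
    ρ.r (mid x) top :=
  ρ.sup_comp h (ρ.refl (mid x))

theorem bot_mid {ρ : LatCon (HSum K L)} {i : K} (h : ρ.r (side i) top) (x : L) :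
    ρ.r bot (mid x) :=
  ρ.inf_comp h (ρ.refl (mid x))

theorem bot_side_of_mid_top {ρ : LatCon (HSum K L)} {x : L} (h : ρ.r (mid x) top) (i : K) :
    ρ.r bot (side i) :=
  ρ.inf_comp h (ρ.refl (side i))

theorem side_top_of_bot_mid {ρ : LatCon (HSum K L)} {x : L} (h : ρ.r bot (mid x)) (i : K) :
    ρ.r (side i) top :=
  ρ.sup_comp h (ρ.refl (side i))

theorem eq_top_of_bot_top {ρ : LatCon (HSum K L)} (h : ρ.r bot top) : ρ = ⊤ :=
  LatCon.eq_top_of_r bot_le' le_top' h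

/-- A congruence not extended from `L` collapses an element outside `L` with a bound. -/
theorem eq_extend_or [Nonempty K] (ρ : LatCon (HSum K L)) :
    ρ = extend (restrict ρ) ∨ ∃ i, ρ.r bot (side i) ∨ ρ.r (side i) top := by
  by_contra! hcon
  obtain ⟨hne, hno⟩ := hcon
  have i₀ : K := Classical.arbitrary K
  have hbt : ¬ ρ.r bot top := fun h => (hno i₀).1 (by
    rw [eq_top_of_bot_top h]
    exact LatCon.top_r _ _)
  have hms : ∀ x i, ¬ ρ.r (mid x) (side i) := fun x i h => by
    have h' := ρ.sup_comp (ρ.refl (mid x)) h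
    rw [sup_idem] at h'
    exact (hno i).1 (bot_side_of_mid_top h' i)
  have hss : ∀ i j, ρ.r (side i) (side j) → i = j := fun i j h => by
    by_contra hij
    have h' := ρ.sup_comp (ρ.refl (side i)) h
    rw [sup_idem, sup_def (side i), sup, if_neg hij] at h'
    exact (hno i).2 h'
  have hbm : ∀ x, ¬ ρ.r bot (mid x) := fun x h => (hno i₀).2 (side_top_of_bot_mid h i₀)
  have hmt : ∀ x, ¬ ρ.r (mid x) top := fun x h => (hno i₀).1 (bot_side_of_mid_top h i₀)
  refine hne (le_antisymm ?_ (extend_le_iff.2 le_rfl))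
  intro p q h
  have h' := ρ.symm h
  rcases p with _ | _ | i | x <;> rcases q with _ | _ | j | y
  case mid.mid => exact .inr ⟨x, y, rfl, rfl, h⟩
  case side.side => exact .inl (congrArg side (hss i j h))
  all_goals first
    | exact .inl rfl
    | exact absurd h hbt
    | exact absurd h' hbt
    | exact absurd h (hbm _)
    | exact absurd h' (hbm _)
    | exact absurd h (hmt _)
    | exact absurd h' (hmt _)
    | exact absurd h (hms _ _)
    | exact absurd h' (hms _ _)
    | exact absurd h (hno _).1
    | exact absurd h' (hno _).1
    | exact absurd h (hno _).2
    | exact absurd h' (hno _).2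

theorem eq_extend_or_eq_top [Nontrivial K] [Nonempty L] (ρ : LatCon (HSum K L)) :
    ρ = extend (restrict ρ) ∨ ρ = ⊤ := by
  refine (eq_extend_or ρ).imp_right ?_
  obtain ⟨x⟩ := ‹Nonempty L›
  rintro ⟨i, h⟩
  obtain ⟨j, hj⟩ := exists_ne i
  apply eq_top_of_bot_top
  rcases h with h | h
  · have h1 := ρ.sup_comp h (ρ.refl (side j))
    rw [sup_def (side i), sup, if_neg hj.symm] at h1
    exact ρ.trans (bot_side_of_mid_top (mid_top h x) j) h1
  · have h1 := ρ.inf_comp h (ρ.refl (side j))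
    rw [inf_def (side i), inf, if_neg hj.symm] at h1
    exact ρ.trans h1 (side_top_of_bot_mid (bot_mid h x) j)

/-- With at least two complements, one new greatest congruence is added. -/
noncomputable def withTopOrderIso [Nontrivial K] [Nonempty L] :
    WithTop (LatCon L) ≃o LatCon (HSum K L) :=
  have hnot : ∀ θ : LatCon L, ¬ (⊤ : LatCon (HSum K L)) ≤ extend θ := fun θ =>
    not_le_extend (i := Classical.arbitrary K) θ (.inl (LatCon.top_r _ _))
  RelIso.ofSurjective
    (OrderEmbedding.ofMapLEIff
      (fun o : WithTop (LatCon L) => (WithTop.recTopCoe ⊤ extend o : LatCon (HSum K L)))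
      (fun o o' => by
        induction o using WithTop.recTopCoe <;> induction o' using WithTop.recTopCoe <;>
          simp [extend_le_extend, -top_le_iff, hnot]))
    (fun ρ => by
      rcases eq_extend_or_eq_top ρ with h | h
      exacts [⟨(restrict ρ : LatCon L), h.symm⟩, ⟨⊤, h.symm⟩])

/-- The congruence of `HSum Unit L` with classes `{bot, side}` and `L ∪ {top}`. -/
noncomputable def lowSide : LatCon (HSum Unit L) :=
  LatCon.ker
    (fun
      | bot => false
      | side _ => false
      | mid _ => true
      | top => true)
    (by rintro (_ | _ | _ | _) (_ | _ | _ | _) <;> rfl)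
    (by rintro (_ | _ | _ | _) (_ | _ | _ | _) <;> rfl)

/-- The congruence of `HSum Unit L` with classes `{bot} ∪ L` and `{side, top}`. -/
noncomputable def highSide : LatCon (HSum Unit L) :=
  LatCon.ker
    (fun
      | bot => false
      | mid _ => false
      | side _ => true
      | top => true)
    (by rintro (_ | _ | _ | _) (_ | _ | _ | _) <;> rfl)
    (by rintro (_ | _ | _ | _) (_ | _ | _ | _) <;> rfl)

theorem lowSide_le_iff {ρ : LatCon (HSum Unit L)} :
    lowSide ≤ ρ ↔ ρ.r bot (side ()) := by
  refine ⟨fun h => h _ _ rfl, fun h => ?_⟩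
  have key : ∀ x y, ρ.r (mid x) (mid y) := fun x y =>
    ρ.trans (mid_top h x) (ρ.symm (mid_top h y))
  rintro (_ | _ | _ | x) (_ | _ | _ | y) hpq
  all_goals first
    | exact ρ.refl _
    | exact h
    | exact ρ.symm h
    | exact key _ _
    | exact mid_top h _
    | exact ρ.symm (mid_top h _)
    | cases hpq

theorem highSide_le_iff {ρ : LatCon (HSum Unit L)} :
    highSide ≤ ρ ↔ ρ.r (side ()) top := by
  refine ⟨fun h => h _ _ rfl, fun h => ?_⟩
  have key : ∀ x y, ρ.r (mid x) (mid y) := fun x y =>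
    ρ.trans (ρ.symm (bot_mid h x)) (bot_mid h y)
  rintro (_ | _ | _ | x) (_ | _ | _ | y) hpq
  all_goals first
    | exact ρ.refl _
    | exact h
    | exact ρ.symm h
    | exact key _ _
    | exact bot_mid h _
    | exact ρ.symm (bot_mid h _)
    | cases hpq

theorem le_lowSide {ρ : LatCon (HSum Unit L)} (h : ¬ ρ.r (side ()) top) : ρ ≤ lowSide := by
  have hbm : ∀ x, ¬ ρ.r bot (mid x) := fun x hx => h (side_top_of_bot_mid hx ())
  have hbt : ¬ ρ.r bot top := fun hx => h (by
    rw [eq_top_of_bot_top hx]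
    exact LatCon.top_r _ _)
  have hsm : ∀ x, ¬ ρ.r (side ()) (mid x) := fun x hx =>
    hbm x (inf_idem (mid x : HSum Unit L) ▸ ρ.inf_comp hx (ρ.refl (mid x)))
  rintro (_ | _ | _ | x) (_ | _ | _ | y) hpq
  all_goals have hqp := ρ.symm hpq
  all_goals first
    | exact rfl
    | exact absurd hpq h
    | exact absurd hqp h
    | exact absurd hpq hbt
    | exact absurd hqp hbt
    | exact absurd hpq (hbm _)
    | exact absurd hqp (hbm _)
    | exact absurd hpq (hsm _)
    | exact absurd hqp (hsm _)

theorem le_highSide {ρ : LatCon (HSum Unit L)} (h : ¬ ρ.r bot (side ())) : ρ ≤ highSide := by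
  have hmt : ∀ x, ¬ ρ.r (mid x) top := fun x hx => h (bot_side_of_mid_top hx ())
  have hbt : ¬ ρ.r bot top := fun hx => h (by
    rw [eq_top_of_bot_top hx]
    exact LatCon.top_r _ _)
  have hsm : ∀ x, ¬ ρ.r (side ()) (mid x) := fun x hx =>
    hmt x (ρ.symm (sup_idem (mid x : HSum Unit L) ▸ ρ.sup_comp hx (ρ.refl (mid x))))
  rintro (_ | _ | _ | x) (_ | _ | _ | y) hpq
  all_goals have hqp := ρ.symm hpq
  all_goals first
    | exact rfl
    | exact absurd hpq h
    | exact absurd hqp h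
    | exact absurd hpq hbt
    | exact absurd hqp hbt
    | exact absurd hpq (hmt _)
    | exact absurd hqp (hmt _)
    | exact absurd hpq (hsm _)
    | exact absurd hqp (hsm _)

theorem eq_cases_of_unit (ρ : LatCon (HSum Unit L)) :
    ρ = extend (restrict ρ) ∨ ρ = lowSide ∨ ρ = highSide ∨ ρ = ⊤ := by
  rcases eq_extend_or ρ with h | ⟨⟨⟩, h⟩
  · exact .inl h
  by_cases h1 : ρ.r bot (side ()) <;> by_cases h2 : ρ.r (side ()) top
  · exact .inr (.inr (.inr (eq_top_of_bot_top (ρ.trans h1 h2))))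
  · exact .inr (.inl (le_antisymm (le_lowSide h2) (lowSide_le_iff.2 h1)))
  · exact .inr (.inr (.inl (le_antisymm (le_highSide h1) (highSide_le_iff.2 h2))))
  · exact absurd h (by tauto)

theorem extend_le_lowSide (θ : LatCon L) : extend θ ≤ lowSide :=
  extend_le_iff.2 fun _ _ _ => rfl

theorem extend_le_highSide (θ : LatCon L) : extend θ ≤ highSide :=
  extend_le_iff.2 fun _ _ _ => rfl

theorem not_lowSide_le_highSide : ¬ (lowSide : LatCon (HSum Unit L)) ≤ highSide := by
  rw [lowSide_le_iff]
  exact Bool.false_ne_true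

theorem not_highSide_le_lowSide : ¬ (highSide : LatCon (HSum Unit L)) ≤ lowSide := by
  rw [highSide_le_iff]
  exact Bool.false_ne_true

/-- With one complement, a four-element Boolean lattice is glued on top of the congruence
lattice. -/
theorem nonempty_orderIso_of_unit {D : Type*} [Lattice D] [BoundedOrder D] {a b : D}
    (hab : ¬ a ≤ b) (hba : ¬ b ≤ a) (hD : ∀ x, x ≤ a ⊓ b ∨ x = a ∨ x = b ∨ x = ⊤)
    (ψ : Set.Iic (a ⊓ b) ≃o LatCon L) : Nonempty (LatCon (HSum Unit L) ≃o D) := by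
  classical
  have ha : ¬ a ≤ a ⊓ b := fun h => hab (h.trans inf_le_right)
  have hb : ¬ b ≤ a ⊓ b := fun h => hba (h.trans inf_le_left)
  have hta : ¬ ⊤ ≤ a := fun h => hba (le_top.trans h)
  have htb : ¬ ⊤ ≤ b := fun h => hab (le_top.trans h)
  have ht : ¬ ⊤ ≤ a ⊓ b := fun h => hta (h.trans inf_le_left)
  let f : D → LatCon (HSum Unit L) := fun x =>
    if hx : x ≤ a ⊓ b then extend (ψ ⟨x, hx⟩)
    else if x = a then lowSide else if x = b then highSide else ⊤
  have f0 : ∀ x (hx : x ≤ a ⊓ b), f x = extend (ψ ⟨x, hx⟩) := fun x hx => dif_pos hx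
  have fa : f a = lowSide := by simp only [f, dif_neg ha, if_true]
  have fb : f b = highSide := by
    simp only [f, dif_neg hb, if_neg (fun h : b = a => hba h.le), if_true]
  have ft : f ⊤ = ⊤ := by
    simp only [f, dif_neg ht, if_neg (fun h : ⊤ = a => hta h.le),
      if_neg (fun h : ⊤ = b => htb h.le)]
  have ht_low : ¬ (⊤ : LatCon (HSum Unit L)) ≤ lowSide := fun h =>
    not_highSide_le_lowSide (le_top.trans h)
  have ht_high : ¬ (⊤ : LatCon (HSum Unit L)) ≤ highSide := fun h =>
    not_lowSide_le_highSide (le_top.trans h)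
  have hlow : ∀ θ : LatCon L, ¬ lowSide ≤ extend θ := fun θ =>
    not_le_extend (i := ()) θ (.inl rfl)
  have hhigh : ∀ θ : LatCon L, ¬ highSide ≤ extend θ := fun θ =>
    not_le_extend (i := ()) θ (.inr rfl)
  have ht_ext : ∀ θ : LatCon L, ¬ (⊤ : LatCon (HSum Unit L)) ≤ extend θ := fun θ h =>
    hlow θ (le_top.trans h)
  have hf : ∀ x y, f x ≤ f y ↔ x ≤ y := by
    intro x y
    rcases hD x with hx | rfl | rfl | rfl <;> rcases hD y with hy | rfl | rfl | rfl
    · rw [f0 x hx, f0 y hy, extend_le_extend, ψ.le_iff_le]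
      exact Iff.rfl
    · rw [f0 x hx, fa]
      exact iff_of_true (extend_le_lowSide _) (hx.trans inf_le_left)
    · rw [f0 x hx, fb]
      exact iff_of_true (extend_le_highSide _) (hx.trans inf_le_right)
    · rw [ft]
      exact iff_of_true le_top le_top
    · rw [fa, f0 y hy]
      exact iff_of_false (hlow _) fun h => ha (h.trans hy)
    · exact iff_of_true le_rfl le_rfl
    · rw [fa, fb]
      exact iff_of_false not_lowSide_le_highSide hab
    · rw [ft]
      exact iff_of_true le_top le_top
    · rw [fb, f0 y hy]
      exact iff_of_false (hhigh _) fun h => hb (h.trans hy)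
    · rw [fa, fb]
      exact iff_of_false not_highSide_le_lowSide hba
    · exact iff_of_true le_rfl le_rfl
    · rw [ft]
      exact iff_of_true le_top le_top
    · rw [ft, f0 y hy]
      exact iff_of_false (ht_ext _) fun h => ht (h.trans hy)
    · rw [ft, fa]
      exact iff_of_false ht_low hta
    · rw [ft, fb]
      exact iff_of_false ht_high htb
    · exact iff_of_true le_rfl le_rfl
  have hsurj : Function.Surjective f := by
    intro ρ
    rcases eq_cases_of_unit ρ with h | h | h | h
    · refine ⟨ψ.symm (restrict ρ), ?_⟩
      rw [f0 _ (ψ.symm (restrict ρ)).2, Subtype.coe_eta, ψ.apply_symm_apply]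
      exact h.symm
    exacts [⟨a, fa.trans h.symm⟩, ⟨b, fb.trans h.symm⟩, ⟨⊤, ft.trans h.symm⟩]
  exact ⟨(RelIso.ofSurjective (OrderEmbedding.ofMapLEIff f hf) hsurj).symm⟩

end HSum

/-- Every finite nonempty chain is the congruence lattice of a finite lattice. -/
theorem exists_latCon_orderIso_fin (n : ℕ) :
    ∃ (L : Type) (_ : Lattice L) (_ : Finite L) (_ : Nonempty L),
      Nonempty (LatCon L ≃o Fin (n + 1)) := by
  induction n with
  | zero =>
    refine ⟨Unit, inferInstance, inferInstance, inferInstance, ?_⟩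
    have : Subsingleton (LatCon Unit) :=
      ⟨fun θ ψ => LatCon.ext' fun a b => iff_of_true (θ.refl a) (ψ.refl a)⟩
    have : Subsingleton (Fin (0 + 1)) := inferInstanceAs (Subsingleton (Fin 1))
    exact ⟨{ toFun := fun _ => 0
             invFun := fun _ => ⊤
             left_inv := fun _ => Subsingleton.elim _ _
             right_inv := fun _ => Subsingleton.elim _ _
             map_rel_iff' := fun {a b} => iff_of_true le_rfl (Subsingleton.elim a b).le }⟩
  | succ n ih =>
    obtain ⟨L, _, _, _, ⟨e⟩⟩ := ih
    refine ⟨HSum Bool L, inferInstance, inferInstance, ⟨.bot⟩, ?_⟩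
    have hcard : Fintype.card (WithTop (Fin (n + 1))) = n + 1 + 1 := by
      rw [Fintype.card_eq_nat_card]
      exact Finite.card_option.trans (by simp)
    exact ⟨HSum.withTopOrderIso.symm.trans
      (e.withTopCongr.trans (Fintype.orderIsoFinOfCardEq _ hcard).symm)⟩

theorem exists_latCon_orderIso_of_total (E : Type*) [PartialOrder E] [Finite E] [Nonempty E]
    (hE : ∀ x y : E, x ≤ y ∨ y ≤ x) :
    ∃ (L : Type) (_ : Lattice L) (_ : Finite L) (_ : Nonempty L),
      Nonempty (LatCon L ≃o E) := by
  classical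
  have := Fintype.ofFinite E
  let _ : LinearOrder E :=
    { (inferInstance : PartialOrder E) with
      le_total := hE
      toDecidableLE := Classical.decRel _ }
  obtain ⟨n, hn⟩ := Nat.exists_eq_succ_of_ne_zero (Fintype.card_ne_zero (α := E))
  obtain ⟨L, i₁, i₂, i₃, ⟨e⟩⟩ := exists_latCon_orderIso_fin n
  exact ⟨L, i₁, i₂, i₃, ⟨e.trans (Fintype.orderIsoFinOfCardEq E hn)⟩⟩

section Structure

variable {D : Type*} [DistribLattice D] [BoundedOrder D]

theorem sup_eq_top_of_Jplus_eq_univ (h : Jplus D = Set.univ) {a b : D} (hab : ¬ a ≤ b)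
    (hba : ¬ b ≤ a) : a ⊔ b = ⊤ := by
  have hmem : a ⊔ b ∈ Jplus D := h ▸ Set.mem_univ _
  rcases hmem with (h0 | h1) | hirr
  · exact absurd (le_sup_left.trans (h0.le.trans bot_le)) hab
  · exact h1
  · rcases hirr.2 rfl with h' | h'
    exacts [absurd (h' ▸ le_sup_right) hba, absurd (h' ▸ le_sup_left) hab]

theorem supIrred_of_Jplus_eq_univ (h : Jplus D = Set.univ) {a b : D} (hab : ¬ a ≤ b)
    (hba : ¬ b ≤ a) : SupIrred a := by
  have hmem : a ∈ Jplus D := h ▸ Set.mem_univ _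
  rcases hmem with (h0 | h1) | hirr
  · exact absurd (h0.le.trans bot_le) hab
  · exact absurd (le_top.trans h1.ge) hba
  · exact hirr

/-- If `a` and `b` are incomparable, every element strictly below `a` is below `b`. -/
theorem eq_of_le_of_not_le (h : Jplus D = Set.univ) {a b x : D} (hab : ¬ a ≤ b)
    (hba : ¬ b ≤ a) (hx : x ≤ a) (hxb : ¬ x ≤ b) : x = a := by
  have hsup := sup_eq_top_of_Jplus_eq_univ h hxb fun hbx => hba (hbx.trans hx)
  have : a ⊓ x ⊔ a ⊓ b = a := by rw [← inf_sup_left, hsup, inf_top_eq]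
  rcases (supIrred_of_Jplus_eq_univ h hab hba).2 this with h' | h'
  exacts [hx.antisymm (inf_eq_left.1 h'), absurd (inf_eq_left.1 h') hab]

theorem le_inf_or_of_Jplus_eq_univ (h : Jplus D = Set.univ) {a b : D} (hab : ¬ a ≤ b)
    (hba : ¬ b ≤ a) (x : D) : x ≤ a ⊓ b ∨ x = a ∨ x = b ∨ x = ⊤ := by
  have htop := sup_eq_top_of_Jplus_eq_univ h hab hba
  by_cases hxa : x ≤ a <;> by_cases hxb : x ≤ b
  · exact .inl (le_inf hxa hxb)
  · exact .inr (.inl (eq_of_le_of_not_le h hab hba hxa hxb))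
  · exact .inr (.inr (.inl (eq_of_le_of_not_le h hba hab hxb hxa)))
  · have hmem : x ∈ Jplus D := h ▸ Set.mem_univ _
    rcases hmem with (h0 | h1) | hirr
    · exact absurd (h0.le.trans bot_le) hxa
    · exact .inr (.inr (.inr h1))
    · have : x ⊓ a ⊔ x ⊓ b = x := by rw [← inf_sup_left, htop, inf_top_eq]
      rcases hirr.2 this with h' | h'
      exacts [absurd (inf_eq_left.1 h') hxa, absurd (inf_eq_left.1 h') hxb]

/-- The elements below the meet of two incomparable elements form a chain. -/
theorem total_Iic_inf (h : Jplus D = Set.univ) {a b : D} (hab : ¬ a ≤ b)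
    (x y : Set.Iic (a ⊓ b)) : x ≤ y ∨ y ≤ x := by
  by_contra! hxy
  have hsup := sup_eq_top_of_Jplus_eq_univ h (a := (x : D)) (b := y) hxy.1 hxy.2
  have : a ≤ a ⊓ b := le_top.trans (hsup.ge.trans (sup_le x.2 y.2))
  exact hab (this.trans inf_le_right)

theorem exists_latCon_orderIso_of_Jplus_eq_univ [Finite D] (h : Jplus D = Set.univ) :
    ∃ (L : Type) (_ : Lattice L) (_ : Finite L) (_ : Nonempty L),
      Nonempty (LatCon L ≃o D) := by
  by_cases htot : ∀ x y : D, x ≤ y ∨ y ≤ x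
  · exact exists_latCon_orderIso_of_total D htot
  push Not at htot
  obtain ⟨a, b, hab, hba⟩ := htot
  obtain ⟨L, _, _, _, ⟨e⟩⟩ :=
    exists_latCon_orderIso_of_total (Set.Iic (a ⊓ b)) (total_Iic_inf h hab)
  exact ⟨HSum Unit L, inferInstance, inferInstance, ⟨.bot⟩,
    HSum.nonempty_orderIso_of_unit hab hba (le_inf_or_of_Jplus_eq_univ h hab hba) e.symm⟩

end Structure

/-- **Lemma 6.** If every element of the finite distributive lattice `D` is `⊥`, `⊤`,
or join-irreducible (i.e. `J⁺(D) = D`), then `D` is fully representable. -/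
theorem fullyRepresentable_of_Jplus_eq_univ
    (D : Type*) [DistribLattice D] [Fintype D] [BoundedOrder D]
    (h : Jplus D = Set.univ) :
    FullyRepresentable D := by
  intro Q hQ
  obtain rfl : Q = Set.univ := Set.univ_subset_iff.1 (h ▸ hQ)
  obtain ⟨L, _, _, _, ⟨φ⟩⟩ := exists_latCon_orderIso_of_Jplus_eq_univ h
  refine ⟨L, inferInstance, Fintype.ofFinite L, φ, Set.eq_univ_of_forall fun x => ?_⟩
  refine ⟨φ.symm x, LatCon.isPrincipal_of_mem_Jplus ?_, φ.apply_symm_apply x⟩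
  have hmem : x ∈ Jplus D := h ▸ Set.mem_univ _
  rcases hmem with (rfl | rfl) | hirr
  · exact .inl φ.symm.map_bot
  · exact .inr (.inl φ.symm.map_top)
  · refine .inr (.inr ⟨fun hmin => hirr.1 ?_, fun y z hyz => ?_⟩)
    · have := φ.symm.map_bot ▸ isMin_iff_eq_bot.1 hmin
      exact isMin_iff_eq_bot.2 (φ.symm.injective this)
    · have : φ y ⊔ φ z = x := by rw [← φ.map_sup, hyz, φ.apply_symm_apply]
      refine (hirr.2 this).imp ?_ ?_ <;> exact fun h' => φ.injective (by simpa using h')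
end
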